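/- In dimension N = 13, the centroids of the 3-skeleton and of the 8-skeleton of the standard simplex coincide: C_{3,13} = C_{8,13} = (23/(13·24)) · (e_1 + e_2 + ⋯ + e_13). -/

import Mathlib

open MeasureTheory

/-- The vertices of the standard simplex in `ℝ^N`: the origin together with the standard
basis vectors `e_1, …, e_N`. -/
noncomputable def simplexVertex (N : ℕ) (i : Fin (N + 1)) : EuclideanSpace ℝ (Fin N) :=
  if h : i = 0 then 0 else EuclideanSpace.single (i.pred h) 1

/-- The `k`-skeleton of the standard simplex in `ℝ^N`: the union of the convex hulls of
all `(k+1)`-element subsets of the vertex set `{0, e_1, …, e_N}`. -/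
def simplexSkeleton (N k : ℕ) : Set (EuclideanSpace ℝ (Fin N)) :=
  ⋃ s ∈ {s : Finset (Fin (N + 1)) | s.card = k + 1}, convexHull ℝ (simplexVertex N '' ↑s)

/-- The centroid `C_{k,N}` of the `k`-skeleton of the standard simplex in `ℝ^N`: the
vector-valued integral of the identity over the skeleton with respect to `k`-dimensional
Hausdorff measure, divided by the total `k`-dimensional Hausdorff measure of the
skeleton. -/
noncomputable def skeletonCentroid (N k : ℕ) : EuclideanSpace ℝ (Fin N) :=
  (μH[(k : ℝ)] (simplexSkeleton N k)).toReal⁻¹ •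
    ∫ x in simplexSkeleton N k, x ∂(μH[(k : ℝ)])

open Module

section Simplex

variable {k : ℕ} {V : Type*} [NormedAddCommGroup V] [InnerProductSpace ℝ V]

theorem affineIndependent_simplexVertex (N : ℕ) : AffineIndependent ℝ (simplexVertex N) := by
  rw [affineIndependent_iff_linearIndependent_vsub ℝ _ (0 : Fin (N + 1))]
  have h := (EuclideanSpace.orthonormal_single (𝕜 := ℝ) (ι := Fin N)).linearIndependent
  have hinj : Function.Injective
      (fun i : {x : Fin (N + 1) // x ≠ 0} ↦ (i : Fin (N + 1)).pred i.2) := by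
    intro i j hij
    exact Subtype.ext (Fin.pred_inj.mp hij)
  have heq : (fun i : {x : Fin (N + 1) // x ≠ 0} ↦ simplexVertex N i -ᵥ simplexVertex N 0) =
      (fun j : Fin N ↦ EuclideanSpace.single j (1 : ℝ)) ∘
        fun i : {x : Fin (N + 1) // x ≠ 0} ↦ (i : Fin (N + 1)).pred i.2 := by
    ext1 i
    simp [simplexVertex, i.2]
  rw [heq]
  exact h.comp _ hinj

@[simp]
theorem simplexVertex_zero (N : ℕ) : simplexVertex N 0 = 0 := by simp [simplexVertex]

@[simp]
theorem simplexVertex_succ (N : ℕ) (i : Fin N) :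
    simplexVertex N i.succ = EuclideanSpace.single i 1 := by simp [simplexVertex]

/-- The corner simplex in `ℝ^k`, with vertices the origin and the standard basis vectors. -/
def cornerSimplex (k : ℕ) : Set (EuclideanSpace ℝ (Fin k)) :=
  convexHull ℝ (Set.range (simplexVertex k))

theorem isCompact_cornerSimplex (k : ℕ) : IsCompact (cornerSimplex k) :=
  (Set.finite_range _).isCompact_convexHull ℝ

theorem hausdorffMeasure_cornerSimplex_lt_top (k : ℕ) :
    μH[(k : ℝ)] (cornerSimplex k) < ⊤ :=
  (isCompact_cornerSimplex k).measure_lt_top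

theorem hausdorffMeasure_cornerSimplex_pos (k : ℕ) : 0 < μH[(k : ℝ)] (cornerSimplex k) := by
  refine Measure.measure_pos_of_nonempty_interior _ ?_
  rw [cornerSimplex, interior_convexHull_nonempty_iff_affineSpan_eq_top,
    (affineIndependent_simplexVertex k).affineSpan_eq_top_iff_card_eq_finrank_add_one]
  simp

/-- The linear part of `simplexMap p`. -/
noncomputable def simplexLinear (p : Fin (k + 1) → V) : EuclideanSpace ℝ (Fin k) →ₗ[ℝ] V :=
  (EuclideanSpace.basisFun (Fin k) ℝ).toBasis.constr ℝ (fun i ↦ p i.succ - p 0)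

theorem simplexLinear_apply (p : Fin (k + 1) → V) (x : EuclideanSpace ℝ (Fin k)) :
    simplexLinear p x = ∑ i, x i • (p i.succ - p 0) := by
  simp [simplexLinear, Basis.constr_apply_fintype]

theorem simplexLinear_single (p : Fin (k + 1) → V) (i : Fin k) :
    simplexLinear p (EuclideanSpace.single i 1) = p i.succ - p 0 := by
  simp [simplexLinear_apply]

/-- The affine map sending the vertices of the corner simplex to the points `p`. -/
noncomputable def simplexMap (p : Fin (k + 1) → V) : EuclideanSpace ℝ (Fin k) →ᵃ[ℝ] V :=
  (simplexLinear p).toAffineMap + AffineMap.const ℝ _ (p 0)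

theorem simplexMap_apply (p : Fin (k + 1) → V) (x : EuclideanSpace ℝ (Fin k)) :
    simplexMap p x = simplexLinear p x + p 0 := rfl

theorem simplexMap_simplexVertex (p : Fin (k + 1) → V) (i : Fin (k + 1)) :
    simplexMap p (simplexVertex k i) = p i := by
  cases i using Fin.cases <;> simp [simplexMap_apply, simplexLinear_single]

theorem simplexMap_image_cornerSimplex (p : Fin (k + 1) → V) :
    simplexMap p '' cornerSimplex k = convexHull ℝ (Set.range p) := by
  rw [cornerSimplex, AffineMap.image_convexHull, ← Set.range_comp]
  congr 2
  ext1 i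
  exact simplexMap_simplexVertex p i

theorem ker_simplexLinear {p : Fin (k + 1) → V} (hp : AffineIndependent ℝ p) :
    (simplexLinear p).ker = ⊥ := by
  rw [affineIndependent_iff_linearIndependent_vsub ℝ _ (0 : Fin (k + 1))] at hp
  have h : LinearIndependent ℝ fun i : Fin k ↦ p i.succ - p 0 :=
    hp.comp (fun i : Fin k ↦ ⟨i.succ, i.succ_ne_zero⟩) fun i j hij ↦
      Fin.succ_injective _ (congrArg Subtype.val hij)
  rw [LinearMap.ker_eq_bot']
  intro x hx
  rw [simplexLinear_apply] at hx
  ext i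
  exact Fintype.linearIndependent_iff.mp h _ hx i

theorem simplexLinear_normDet_pos {p : Fin (k + 1) → V} (hp : AffineIndependent ℝ p) :
    0 < (simplexLinear p).normDet := by
  refine lt_of_le_of_ne (LinearMap.normDet_nonneg _) (Ne.symm ?_)
  rw [Ne, LinearMap.normDet_eq_zero_iff_ker_ne_bot, not_not]
  exact ker_simplexLinear hp

variable [MeasurableSpace V] [BorelSpace V]

theorem measurableEmbedding_simplexMap {p : Fin (k + 1) → V} (hp : AffineIndependent ℝ p) :
    MeasurableEmbedding (simplexMap p) :=
  ((Homeomorph.addRight (p 0)).isClosedEmbedding.comp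
    (LinearMap.isClosedEmbedding_of_injective (ker_simplexLinear hp))).measurableEmbedding

theorem hausdorffMeasure_image_simplexMap (p : Fin (k + 1) → V)
    (s : Set (EuclideanSpace ℝ (Fin k))) :
    μH[(k : ℝ)] (simplexMap p '' s) =
      ENNReal.ofReal (simplexLinear p).normDet * μH[(k : ℝ)] s := by
  have h := (simplexLinear p).hausdorffMeasure_image s
  rw [finrank_euclideanSpace_fin] at h
  rw [← h, ← (IsometryEquiv.addRight (p 0)).hausdorffMeasure_image (k : ℝ)
    (simplexLinear p '' s), Set.image_image]
  rfl

theorem restrict_convexHull_eq_map {p : Fin (k + 1) → V} (hp : AffineIndependent ℝ p) :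
    (μH[(k : ℝ)]).restrict (convexHull ℝ (Set.range p)) =
      ENNReal.ofReal (simplexLinear p).normDet •
        ((μH[(k : ℝ)]).restrict (cornerSimplex k)).map (simplexMap p) := by
  have he := measurableEmbedding_simplexMap hp
  ext s hs
  rw [Measure.restrict_apply hs, Measure.smul_apply, he.map_apply,
    Measure.restrict_apply (he.measurable hs), smul_eq_mul,
    ← hausdorffMeasure_image_simplexMap, Set.image_preimage_inter,
    simplexMap_image_cornerSimplex]

theorem setIntegral_convexHull {W : Type*} [NormedAddCommGroup W] [NormedSpace ℝ W]
    {p : Fin (k + 1) → V} (hp : AffineIndependent ℝ p) (f : V → W) :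
    ∫ x in convexHull ℝ (Set.range p), f x ∂μH[(k : ℝ)] =
      (simplexLinear p).normDet • ∫ x in cornerSimplex k, f (simplexMap p x) ∂μH[(k : ℝ)] := by
  rw [restrict_convexHull_eq_map hp, integral_smul_measure,
    (measurableEmbedding_simplexMap hp).integral_map,
    ENNReal.toReal_ofReal (LinearMap.normDet_nonneg _)]

theorem hausdorffMeasure_convexHull (p : Fin (k + 1) → V) :
    μH[(k : ℝ)] (convexHull ℝ (Set.range p)) =
      ENNReal.ofReal (simplexLinear p).normDet * μH[(k : ℝ)] (cornerSimplex k) := by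
  rw [← simplexMap_image_cornerSimplex, hausdorffMeasure_image_simplexMap]

omit [MeasurableSpace V] [BorelSpace V] in
theorem simplexMap_eq_sum (p : Fin (k + 1) → V) (x : EuclideanSpace ℝ (Fin k)) :
    simplexMap p x =
      ∑ i, simplexMap (fun j : Fin (k + 1) ↦ EuclideanSpace.single j (1 : ℝ)) x i • p i := by
  have h (i : Fin k) : (0 : Fin (k + 1)) ≠ i.succ := (Fin.succ_ne_zero i).symm
  simp [h, simplexMap_apply, simplexLinear_apply, Fin.sum_univ_succ, smul_sub, sub_smul, add_smul,
    Finset.sum_smul, Pi.single_apply, Fin.succ_ne_zero, Finset.sum_sub_distrib]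
  abel

theorem affineIndependent_single (n : ℕ) :
    AffineIndependent ℝ (fun j : Fin n ↦ EuclideanSpace.single j (1 : ℝ)) :=
  EuclideanSpace.orthonormal_single.linearIndependent.affineIndependent

theorem integral_convexHull_single_eq (k : ℕ) (i j : Fin (k + 1)) :
    ∫ y in convexHull ℝ (Set.range fun j : Fin (k + 1) ↦ EuclideanSpace.single j (1 : ℝ)), y i
        ∂μH[(k : ℝ)] =
      ∫ y in convexHull ℝ (Set.range fun j : Fin (k + 1) ↦ EuclideanSpace.single j (1 : ℝ)), y j
        ∂μH[(k : ℝ)] := by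
  let e := LinearIsometryEquiv.piLpCongrLeft 2 ℝ ℝ (Equiv.swap i j)
  set S := convexHull ℝ (Set.range fun j : Fin (k + 1) ↦ EuclideanSpace.single j (1 : ℝ)) with hS
  have himg : e '' S = S := by
    have := e.toLinearEquiv.toLinearMap.image_convexHull
      (Set.range fun j : Fin (k + 1) ↦ EuclideanSpace.single j (1 : ℝ))
    refine this.trans ?_
    rw [hS, ← Set.range_comp, ← (Equiv.swap i j).surjective.range_comp
      (fun j : Fin (k + 1) ↦ EuclideanSpace.single j (1 : ℝ))]
    congr 2
    ext1 l
    exact LinearIsometryEquiv.piLpCongrLeft_single (p := 2) (𝕜 := ℝ) (Equiv.swap i j) l (1 : ℝ)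
  have h := (e.toIsometryEquiv.measurePreserving_hausdorffMeasure (k : ℝ)).setIntegral_image_emb
    e.toHomeomorph.measurableEmbedding (fun y ↦ y i) S
  refine (congrArg (fun A : Set (EuclideanSpace ℝ (Fin (k + 1))) ↦
    ∫ y in A, y i ∂μH[(k : ℝ)]) himg).symm.trans (h.trans ?_)
  refine integral_congr_ae (.of_forall fun y ↦ ?_)
  change e y i = y j
  simp [e, LinearIsometryEquiv.piLpCongrLeft_apply, Equiv.piCongrLeft'_apply]

omit [MeasurableSpace V] [BorelSpace V] in
theorem continuous_simplexMap (p : Fin (k + 1) → V) : Continuous (simplexMap p) :=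
  AffineMap.continuous_of_finiteDimensional _

theorem integrableOn_cornerSimplex {W : Type*} [NormedAddCommGroup W]
    {f : EuclideanSpace ℝ (Fin k) → W} (hf : Continuous f) :
    IntegrableOn f (cornerSimplex k) μH[(k : ℝ)] :=
  hf.continuousOn.integrableOn_compact (isCompact_cornerSimplex k)

theorem sum_simplexMap_single (x : EuclideanSpace ℝ (Fin k)) :
    ∑ i, simplexMap (fun j : Fin (k + 1) ↦ EuclideanSpace.single j (1 : ℝ)) x i = 1 := by
  have h (i : Fin k) : (0 : Fin (k + 1)) ≠ i.succ := (Fin.succ_ne_zero i).symm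
  simp [h, simplexMap_apply, simplexLinear_apply, Fin.sum_univ_succ, Pi.single_apply,
    Fin.succ_ne_zero]

theorem integral_simplexMap_single (k : ℕ) (i : Fin (k + 1)) :
    ∫ x in cornerSimplex k,
        simplexMap (fun j : Fin (k + 1) ↦ EuclideanSpace.single j (1 : ℝ)) x i ∂μH[(k : ℝ)] =
      (μH[(k : ℝ)]).real (cornerSimplex k) / (k + 1) := by
  have hind := affineIndependent_single (k + 1)
  have hc (j : Fin (k + 1)) : Continuous fun x : EuclideanSpace ℝ (Fin k) ↦
      simplexMap (fun j : Fin (k + 1) ↦ EuclideanSpace.single j (1 : ℝ)) x j :=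
    (EuclideanSpace.proj (𝕜 := ℝ) j).continuous.comp (continuous_simplexMap _)
  have heq (j : Fin (k + 1)) := integral_convexHull_single_eq k j i
  simp only [setIntegral_convexHull hind, smul_eq_mul,
    mul_right_inj' (simplexLinear_normDet_pos hind).ne'] at heq
  have hsum := integral_finsetSum Finset.univ
    fun j _ ↦ integrableOn_cornerSimplex (hc j)
  simp only [sum_simplexMap_single, heq] at hsum
  rw [eq_div_iff (by positivity), mul_comm]
  simpa using hsum.symm

omit [MeasurableSpace V] [BorelSpace V] in
theorem integral_simplexMap [CompleteSpace V] (p : Fin (k + 1) → V) :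
    ∫ x in cornerSimplex k, simplexMap p x ∂μH[(k : ℝ)] =
      ((μH[(k : ℝ)]).real (cornerSimplex k) / (k + 1)) • ∑ i, p i := by
  have hc (j : Fin (k + 1)) : Continuous fun x : EuclideanSpace ℝ (Fin k) ↦
      simplexMap (fun j : Fin (k + 1) ↦ EuclideanSpace.single j (1 : ℝ)) x j :=
    (EuclideanSpace.proj (𝕜 := ℝ) j).continuous.comp (continuous_simplexMap _)
  simp_rw [simplexMap_eq_sum p]
  rw [integral_finsetSum (f := fun i x ↦
      simplexMap (fun j : Fin (k + 1) ↦ EuclideanSpace.single j (1 : ℝ)) x i • p i) _ fun i _ ↦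
    integrableOn_cornerSimplex ((hc i).smul continuous_const)]
  simp_rw [integral_smul_const, integral_simplexMap_single, Finset.smul_sum]

end Simplex

section Face

variable {N k : ℕ}

/-- The increasing enumeration of the vertices of a `k`-dimensional face. -/
noncomputable def faceVertex (s : Finset (Fin (N + 1))) (hs : s.card = k + 1) (i : Fin (k + 1)) :
    EuclideanSpace ℝ (Fin N) :=
  simplexVertex N (s.orderEmbOfFin hs i)

theorem range_faceVertex (s : Finset (Fin (N + 1))) (hs : s.card = k + 1) :
    Set.range (faceVertex s hs) = simplexVertex N '' s := by
  rw [← Finset.range_orderEmbOfFin s hs, ← Set.range_comp]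
  rfl

theorem affineIndependent_faceVertex (s : Finset (Fin (N + 1))) (hs : s.card = k + 1) :
    AffineIndependent ℝ (faceVertex s hs) :=
  (affineIndependent_simplexVertex N).comp_embedding (s.orderEmbOfFin hs).toEmbedding

theorem sum_faceVertex (s : Finset (Fin (N + 1))) (hs : s.card = k + 1) :
    ∑ i, faceVertex s hs i = ∑ i ∈ s, simplexVertex N i := by
  conv_rhs => rw [← Finset.map_orderEmbOfFin_univ s hs, Finset.sum_map]
  rfl

theorem inner_simplexVertex {i j : Fin (N + 1)} (hi : i ≠ 0) :
    inner ℝ (simplexVertex N i) (simplexVertex N j) = if i = j then 1 else 0 := by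
  obtain ⟨i, rfl⟩ := Fin.exists_succ_eq_of_ne_zero hi
  cases j using Fin.cases with
  | zero => simp
  | succ j => simp [EuclideanSpace.inner_single_left]

theorem normDet_faceVertex_of_zero_mem {s : Finset (Fin (N + 1))} (hs : s.card = k + 1)
    (h0 : 0 ∈ s) : (simplexLinear (faceVertex s hs)).normDet = 1 := by
  have hmin : s.orderEmbOfFin hs 0 = 0 := by
    obtain ⟨i, hi⟩ : (0 : Fin (N + 1)) ∈ Set.range (s.orderEmbOfFin hs) := by simpa using h0
    exact le_antisymm (hi ▸ (s.orderEmbOfFin hs).monotone (Fin.zero_le i)) (Fin.zero_le _)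
  have hne (i : Fin k) : s.orderEmbOfFin hs i.succ ≠ 0 := by
    rw [← hmin]
    exact (s.orderEmbOfFin hs).injective.ne i.succ_ne_zero
  have h := LinearMap.normDet_sq_eq_det_gram (simplexLinear (faceVertex s hs))
    (EuclideanSpace.basisFun (Fin k) ℝ)
  have hgram : Matrix.gram ℝ (fun i ↦ simplexLinear (faceVertex s hs)
      (EuclideanSpace.basisFun (Fin k) ℝ i)) = 1 := by
    ext i j
    simp [Matrix.gram_apply, simplexLinear_single, faceVertex, hmin, inner_simplexVertex (hne i),
      Matrix.one_apply]
  rw [hgram, Matrix.det_one] at h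
  exact (pow_eq_one_iff_of_nonneg (LinearMap.normDet_nonneg _) two_ne_zero).mp (by simpa using h)

theorem normDet_faceVertex_of_zero_notMem {s : Finset (Fin (N + 1))} (hs : s.card = k + 1)
    (h0 : 0 ∉ s) : (simplexLinear (faceVertex s hs)).normDet = √(k + 1) := by
  have hne (i : Fin (k + 1)) : s.orderEmbOfFin hs i ≠ 0 := fun h ↦
    h0 (h ▸ s.orderEmbOfFin_mem hs i)
  have h := LinearMap.normDet_sq_eq_det_gram (simplexLinear (faceVertex s hs))
    (EuclideanSpace.basisFun (Fin k) ℝ)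
  have hgram : Matrix.gram ℝ (fun i ↦ simplexLinear (faceVertex s hs)
      (EuclideanSpace.basisFun (Fin k) ℝ i)) =
      1 + (Matrix.replicateCol Unit (fun _ ↦ 1) : Matrix (Fin k) Unit ℝ) *
        (Matrix.replicateRow Unit (fun _ ↦ 1) : Matrix Unit (Fin k) ℝ) := by
    ext i j
    rw [Matrix.gram_apply, EuclideanSpace.basisFun_apply, EuclideanSpace.basisFun_apply,
      simplexLinear_single, simplexLinear_single]
    simp only [faceVertex, inner_sub_left, inner_sub_right, inner_simplexVertex (hne _)]
    simp [Matrix.one_apply, Matrix.mul_apply, (Fin.succ_ne_zero j).symm]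
  rw [hgram, Matrix.det_one_add_replicateCol_mul_replicateRow] at h
  rw [eq_comm, Real.sqrt_eq_iff_eq_sq (by positivity) (LinearMap.normDet_nonneg _)]
  simpa [add_comm, dotProduct] using h.symm

theorem hausdorffMeasure_convexHull_eq_zero (t : Finset (Fin (N + 1))) (ht : t.card ≤ k) :
    μH[(k : ℝ)] (convexHull ℝ (simplexVertex N '' t)) = 0 := by
  rcases t.eq_empty_or_nonempty with rfl | hne
  · simp
  obtain ⟨n, hn⟩ := Nat.exists_eq_succ_of_ne_zero hne.card_ne_zero
  have hfin := finrank_vectorSpan_image_finset_le ℝ (simplexVertex N) t hn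
  refine hausdorffMeasure_of_dimH_lt (d := k) ?_
  rw [Real.Convex.dimH_eq_finrank_vectorSpan (convex_convexHull ℝ _)
    (by simpa [convexHull_nonempty_iff] using hne), ← direction_affineSpan, affineSpan_convexHull,
    direction_affineSpan, ← Finset.coe_image]
  exact_mod_cast hfin.trans_lt (by omega)

theorem aedisjoint_convexHull {s t : Finset (Fin (N + 1))} (hs : s.card = k + 1)
    (ht : t.card = k + 1) (hst : s ≠ t) :
    AEDisjoint μH[(k : ℝ)] (convexHull ℝ (simplexVertex N '' s))
      (convexHull ℝ (simplexVertex N '' t)) := by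
  have hind := affineIndependent_simplexVertex N
  have hinter := AffineIndependent.convexHull_inter (R := ℝ)
    (s := Finset.univ.image (simplexVertex N)) (t₁ := s.image (simplexVertex N))
    (t₂ := t.image (simplexVertex N)) (hind.range.mono (by simp))
    (Finset.image_subset_image s.subset_univ) (Finset.image_subset_image t.subset_univ)
  rw [AEDisjoint, ← Finset.coe_image, ← Finset.coe_image, ← hinter, Finset.coe_image,
    Finset.coe_image, ← Set.image_inter hind.injective, ← Finset.coe_inter]
  refine hausdorffMeasure_convexHull_eq_zero _ ?_
  by_contra! hcard
  have h1 := Finset.eq_of_subset_of_card_le (Finset.inter_subset_left (s₁ := s) (s₂ := t))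
    (by omega)
  have h2 := Finset.eq_of_subset_of_card_le (Finset.inter_subset_right (s₁ := s) (s₂ := t))
    (by omega)
  exact hst (h1.symm.trans h2)

theorem isCompact_convexHull_simplexVertex (s : Finset (Fin (N + 1))) :
    IsCompact (convexHull ℝ (simplexVertex N '' s)) :=
  (s.finite_toSet.image _).isCompact_convexHull ℝ

theorem restrict_simplexSkeleton (N k : ℕ) :
    (μH[(k : ℝ)]).restrict (simplexSkeleton N k) =
      Measure.sum fun s : {s : Finset (Fin (N + 1)) // s.card = k + 1} ↦
        (μH[(k : ℝ)]).restrict (convexHull ℝ (simplexVertex N '' s.1)) := by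
  rw [simplexSkeleton, Set.biUnion_eq_iUnion]
  exact Measure.restrict_iUnion_ae
    (fun s t hst ↦ aedisjoint_convexHull s.2 t.2 (Subtype.coe_injective.ne hst))
    fun s ↦ (isCompact_convexHull_simplexVertex s.1).measurableSet.nullMeasurableSet

/-- The ratio of the volume of a `k`-dimensional face to that of the corner simplex. -/
noncomputable def faceScale (k : ℕ) (s : Finset (Fin (N + 1))) : ℝ :=
  if 0 ∈ s then 1 else √(k + 1)

theorem faceScale_nonneg (s : Finset (Fin (N + 1))) : 0 ≤ faceScale k s := by
  unfold faceScale
  split_ifs <;> positivity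

theorem normDet_faceVertex (s : Finset (Fin (N + 1))) (hs : s.card = k + 1) :
    (simplexLinear (faceVertex s hs)).normDet = faceScale k s := by
  unfold faceScale
  split_ifs with h0
  · exact normDet_faceVertex_of_zero_mem hs h0
  · exact normDet_faceVertex_of_zero_notMem hs h0

theorem hausdorffMeasure_face (s : Finset (Fin (N + 1))) (hs : s.card = k + 1) :
    μH[(k : ℝ)] (convexHull ℝ (simplexVertex N '' s)) =
      ENNReal.ofReal (faceScale k s) * μH[(k : ℝ)] (cornerSimplex k) := by
  rw [← range_faceVertex s hs, hausdorffMeasure_convexHull, normDet_faceVertex]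

theorem setIntegral_face (s : Finset (Fin (N + 1))) (hs : s.card = k + 1) :
    ∫ x in convexHull ℝ (simplexVertex N '' s), x ∂μH[(k : ℝ)] =
      ((μH[(k : ℝ)]).real (cornerSimplex k) / (k + 1)) •
        faceScale k s • ∑ i ∈ s, simplexVertex N i := by
  rw [← range_faceVertex s hs, setIntegral_convexHull (affineIndependent_faceVertex s hs),
    normDet_faceVertex, integral_simplexMap, sum_faceVertex, smul_comm]

theorem hausdorffMeasure_simplexSkeleton (N k : ℕ) :
    (μH[(k : ℝ)] (simplexSkeleton N k)).toReal =
      (μH[(k : ℝ)]).real (cornerSimplex k) *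
        ∑ s ∈ Finset.powersetCard (k + 1) (Finset.univ : Finset (Fin (N + 1))),
          faceScale k s := by
  rw [← Measure.restrict_apply_univ, restrict_simplexSkeleton,
    Measure.sum_apply _ MeasurableSet.univ, tsum_fintype]
  simp_rw [Measure.restrict_apply_univ]
  rw [Finset.sum_congr rfl fun s _ ↦ hausdorffMeasure_face s.1 s.2,
    ENNReal.toReal_sum fun s _ ↦
      ENNReal.mul_ne_top ENNReal.ofReal_ne_top (hausdorffMeasure_cornerSimplex_lt_top k).ne]
  simp_rw [ENNReal.toReal_mul, ENNReal.toReal_ofReal (faceScale_nonneg _)]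
  rw [← Finset.sum_mul, mul_comm, Measure.real]
  congr 1
  exact (Finset.sum_subtype (p := fun s ↦ s.card = k + 1) _ (fun s ↦ Finset.mem_powersetCard_univ)
    (fun s : Finset (Fin (N + 1)) ↦ faceScale k s)).symm

theorem setIntegral_simplexSkeleton (N k : ℕ) :
    ∫ x in simplexSkeleton N k, x ∂μH[(k : ℝ)] =
      ((μH[(k : ℝ)]).real (cornerSimplex k) / (k + 1)) •
        ∑ s ∈ Finset.powersetCard (k + 1) (Finset.univ : Finset (Fin (N + 1))),
          faceScale k s • ∑ i ∈ s, simplexVertex N i := by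
  have hint (s : {s : Finset (Fin (N + 1)) // s.card = k + 1}) :
      Integrable (fun x ↦ x)
        ((μH[(k : ℝ)]).restrict (convexHull ℝ (simplexVertex N '' s.1))) := by
    have : IsFiniteMeasure
        ((μH[(k : ℝ)]).restrict (convexHull ℝ (simplexVertex N '' s.1))) := by
      refine ⟨?_⟩
      rw [Measure.restrict_apply_univ, hausdorffMeasure_face s.1 s.2]
      exact ENNReal.mul_lt_top ENNReal.ofReal_lt_top (hausdorffMeasure_cornerSimplex_lt_top k)
    obtain ⟨C, hC⟩ := (isCompact_convexHull_simplexVertex s.1).isBounded.exists_norm_le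
    exact Integrable.of_bound aestronglyMeasurable_id C
      ((ae_restrict_iff' (isCompact_convexHull_simplexVertex s.1).measurableSet).mpr
        (.of_forall hC))
  rw [restrict_simplexSkeleton, Measure.sum_fintype, integral_finsetSum_measure fun s _ ↦ hint s,
    Finset.sum_congr rfl fun s _ ↦ setIntegral_face s.1 s.2, ← Finset.smul_sum]
  congr 1
  exact (Finset.sum_subtype (p := fun s ↦ s.card = k + 1) _ (fun s ↦ Finset.mem_powersetCard_univ)
    (fun s : Finset (Fin (N + 1)) ↦ faceScale k s • ∑ i ∈ s, simplexVertex N i)).symm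

theorem skeletonCentroid_eq (N k : ℕ) :
    skeletonCentroid N k =
      ((k + 1) * ∑ s ∈ Finset.powersetCard (k + 1) (Finset.univ : Finset (Fin (N + 1))),
          faceScale k s)⁻¹ •
        ∑ s ∈ Finset.powersetCard (k + 1) (Finset.univ : Finset (Fin (N + 1))),
          faceScale k s • ∑ i ∈ s, simplexVertex N i := by
  have hpos : (μH[(k : ℝ)]).real (cornerSimplex k) ≠ 0 :=
    (ENNReal.toReal_pos (hausdorffMeasure_cornerSimplex_pos k).ne'
      (hausdorffMeasure_cornerSimplex_lt_top k).ne).ne'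
  rw [skeletonCentroid, hausdorffMeasure_simplexSkeleton, setIntegral_simplexSkeleton, smul_smul]
  congr 1
  field_simp

theorem faceScale_eq (s : Finset (Fin (N + 1))) :
    faceScale k s = √(k + 1) + (1 - √(k + 1)) * if 0 ∈ s then 1 else 0 := by
  unfold faceScale
  split_ifs <;> ring

theorem sum_faceScale_of_subset (u : Finset (Fin (N + 1))) (hu : (insert 0 u).card ≤ k + 1) :
    ∑ s ∈ Finset.powersetCard (k + 1) (Finset.univ : Finset (Fin (N + 1))) with u ⊆ s,
        faceScale k s =
      √(k + 1) * (N + 1 - u.card).choose (k + 1 - u.card) +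
        (1 - √(k + 1)) * (N + 1 - (insert 0 u).card).choose (k + 1 - (insert 0 u).card) := by
  simp_rw [faceScale_eq]
  rw [Finset.sum_add_distrib, ← Finset.mul_sum, Finset.sum_boole, Finset.filter_filter,
    Finset.sum_const, nsmul_eq_mul, mul_comm (√_)]
  have h (s : Finset (Fin (N + 1))) : u ⊆ s ∧ 0 ∈ s ↔ insert 0 u ⊆ s := by
    rw [Finset.insert_subset_iff, and_comm]
  simp_rw [h]
  rw [Finset.card_filter_powersetCard_subset _ _ _ (Finset.subset_univ _) hu,
    Finset.card_filter_powersetCard_subset _ _ _ (Finset.subset_univ _)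
      ((Finset.card_le_card (Finset.subset_insert 0 u)).trans hu), Finset.card_fin]

theorem sum_faceScale (N k : ℕ) :
    ∑ s ∈ Finset.powersetCard (k + 1) (Finset.univ : Finset (Fin (N + 1))), faceScale k s =
      √(k + 1) * (N + 1).choose (k + 1) + (1 - √(k + 1)) * N.choose k := by
  simpa using sum_faceScale_of_subset (N := N) (k := k) ∅ (by simp)

theorem sum_faceScale_of_succ_mem (hk : 1 ≤ k) (j : Fin N) :
    ∑ s ∈ Finset.powersetCard (k + 1) (Finset.univ : Finset (Fin (N + 1))) with j.succ ∈ s,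
        faceScale k s =
      √(k + 1) * N.choose k + (1 - √(k + 1)) * (N - 1).choose (k - 1) := by
  have hcard : (insert 0 {j.succ} : Finset (Fin (N + 1))).card = 2 :=
    Finset.card_pair (Fin.succ_ne_zero j).symm
  simpa [hcard] using sum_faceScale_of_subset (k := k) {j.succ} (by omega)

theorem sum_faceScale_smul_sum (hk : 1 ≤ k) :
    ∑ s ∈ Finset.powersetCard (k + 1) (Finset.univ : Finset (Fin (N + 1))),
        faceScale k s • ∑ i ∈ s, simplexVertex N i =
      (√(k + 1) * N.choose k + (1 - √(k + 1)) * (N - 1).choose (k - 1)) •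
        ∑ j : Fin N, EuclideanSpace.single j (1 : ℝ) := by
  have h (s : Finset (Fin (N + 1))) : faceScale k s • ∑ i ∈ s, simplexVertex N i =
      ∑ i, (if i ∈ s then faceScale k s else 0) • simplexVertex N i := by
    simp [Finset.smul_sum, ite_smul, Finset.sum_ite_mem]
  simp_rw [h]
  rw [Finset.sum_comm, Fin.sum_univ_succ]
  simp_rw [← Finset.sum_smul, ← Finset.sum_filter, simplexVertex_succ, simplexVertex_zero,
    sum_faceScale_of_succ_mem hk, smul_zero, zero_add, Finset.smul_sum]

theorem skeletonCentroid_eq_smul (N : ℕ) {k : ℕ} (hk : 1 ≤ k) :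
    skeletonCentroid N k =
      ((√(k + 1) * N.choose k + (1 - √(k + 1)) * (N - 1).choose (k - 1)) /
        ((k + 1) * (√(k + 1) * (N + 1).choose (k + 1) + (1 - √(k + 1)) * N.choose k))) •
        ∑ j : Fin N, EuclideanSpace.single j (1 : ℝ) := by
  rw [skeletonCentroid_eq, sum_faceScale, sum_faceScale_smul_sum hk, smul_smul,
    div_eq_inv_mul]

end Face

/-- In dimension `13`, the centroids of the `3`-skeleton and of the `8`-skeleton of the
standard simplex coincide, and both equal `(23/(13·24)) · (e_1 + ⋯ + e_13)`. -/
theorem centroid_three_eq_centroid_eight :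
    skeletonCentroid 13 3 = skeletonCentroid 13 8 ∧
    skeletonCentroid 13 3 =
      ((23 : ℝ) / (13 * 24)) • ∑ j : Fin 13, EuclideanSpace.single j (1 : ℝ) := by
  have h2 : √(((3 : ℕ) : ℝ) + 1) = 2 := by
    rw [Real.sqrt_eq_iff_eq_sq] <;> norm_num
  have h3 : √(((8 : ℕ) : ℝ) + 1) = 3 := by
    rw [Real.sqrt_eq_iff_eq_sq] <;> norm_num
  rw [skeletonCentroid_eq_smul 13 (k := 3) (by norm_num),
    skeletonCentroid_eq_smul 13 (k := 8) (by norm_num), h2, h3]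
  constructor <;> congr 1 <;> norm_num [Nat.choose]
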